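/- arXiv:1101.3267 — 2 statements merged into one kernel-verified Lean document; each statement's English description precedes it below -/
import Mathlib

section
/- Let A be an integer (r,s)×t bimatrix and consider the n-fold system A⁽ⁿ⁾x = b, l ≤ x ≤ u, x ∈ ℤ^{nt} with finite bounds. Define the auxiliary (r,s)×(t+2r+2s) bimatrix Ā by Ā₁ := (A₁ | I_r | −I_r | 0_{r×s} | 0_{r×s}) and Ā₂ := (A₂ | 0_{s×r} | 0_{s×r} | I_s | −I_s), and consider the auxiliary n-fold program over z ∈ ℤ^{n(t+2r+2s)} with constraints Ā⁽ⁿ⁾z = b, the original bounds l, u on the original coordinates of each brick, bounds 0 ≤ y ≤ ‖b‖_∞ on each auxiliary coordinate, and objective equal to the sum of all auxiliary coordinates. Then: (i) if l ≤ 0 ≤ u componentwise, the auxiliary program has a feasible point; and (ii) the original system {x ∈ ℤ^{nt} : A⁽ⁿ⁾x = b, l ≤ x ≤ u} is nonempty if and only if the auxiliary program has a feasible point with objective value 0. -/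
open Matrix

/-- The conformal (sign-compatible) partial order `x ⊑ y` on integer vectors:
`x k * y k ≥ 0` and `|x k| ≤ |y k|` for every coordinate `k`. -/
def ConformalLe {ν : Type*} (x y : ν → ℤ) : Prop :=
  ∀ k, 0 ≤ x k * y k ∧ |x k| ≤ |y k|

/-- The Graver basis of an integer matrix `A`: the set of `⊑`-minimal elements of
`{x : A x = 0, x ≠ 0}`. -/
def GraverBasis {μ ν : Type*} [Fintype ν] (A : Matrix μ ν ℤ) : Set (ν → ℤ) :=
  {x | A.mulVec x = 0 ∧ x ≠ 0 ∧
    ∀ y, A.mulVec y = 0 → y ≠ 0 → ConformalLe y x → y = x}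

/-- The `ι`-fold product of the bimatrix with blocks `A1` (first block, `r × τ`) and
`A2` (second block, `s × τ`): the first `r` rows are `(A1 A1 ⋯ A1)` and the remaining
rows form a block-diagonal matrix with a copy of `A2` for each index in `ι`. -/
def nFold {r s : ℕ} {τ : Type*} (A1 : Matrix (Fin r) τ ℤ) (A2 : Matrix (Fin s) τ ℤ)
    (ι : Type*) [DecidableEq ι] : Matrix (Fin r ⊕ ι × Fin s) (ι × τ) ℤ :=
  Matrix.of fun i jt =>
    match i with
    | Sum.inl a => A1 a jt.2
    | Sum.inr (k, c) => if jt.1 = k then A2 c jt.2 else 0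

/-- The `i`-th brick of a vector indexed by `ι × τ`. -/
def brick {ι τ : Type*} (x : ι × τ → ℤ) (i : ι) : τ → ℤ := fun j => x (i, j)

/-- The Graver complexity of the bimatrix `(A1, A2)`: the largest number of nonzero
bricks appearing in any element of the Graver basis of any `n`-fold product. -/
noncomputable def graverComplexity {r s t : ℕ} (A1 : Matrix (Fin r) (Fin t) ℤ)
    (A2 : Matrix (Fin s) (Fin t) ℤ) : ℕ :=
  sSup {k : ℕ | ∃ (n : ℕ) (g : Fin n × Fin t → ℤ),
    g ∈ GraverBasis (nFold A1 A2 (Fin n)) ∧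
    k = {i : Fin n | brick g i ≠ 0}.ncard}

/-- `Z(A)`: the set of all vectors in `ℤ^t` that are sums of at most `g(A)` elements
of the Graver basis of `A2`. -/
noncomputable def ZSet {r s t : ℕ} (A1 : Matrix (Fin r) (Fin t) ℤ)
    (A2 : Matrix (Fin s) (Fin t) ℤ) : Set (Fin t → ℤ) :=
  {z | ∃ L : List (Fin t → ℤ), L.length ≤ graverComplexity A1 A2 ∧
    (∀ h ∈ L, h ∈ GraverBasis A2) ∧ z = L.sum}

/-- Column index type of the auxiliary bimatrix: `t` original coordinates followed by
`2r + 2s` auxiliary coordinates. -/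
abbrev AuxCol (r s t : ℕ) : Type := Fin t ⊕ ((Fin r ⊕ Fin r) ⊕ (Fin s ⊕ Fin s))

/-- First block `Ā₁ = (A₁ | I_r | −I_r | 0 | 0)` of the auxiliary bimatrix. -/
def auxA1 {r t : ℕ} (s : ℕ) (A1 : Matrix (Fin r) (Fin t) ℤ) :
    Matrix (Fin r) (AuxCol r s t) ℤ :=
  Matrix.of fun a c =>
    match c with
    | Sum.inl j => A1 a j
    | Sum.inr (Sum.inl (Sum.inl j)) => if j = a then 1 else 0
    | Sum.inr (Sum.inl (Sum.inr j)) => if j = a then -1 else 0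
    | Sum.inr (Sum.inr _) => 0

/-- Second block `Ā₂ = (A₂ | 0 | 0 | I_s | −I_s)` of the auxiliary bimatrix. -/
def auxA2 {s t : ℕ} (r : ℕ) (A2 : Matrix (Fin s) (Fin t) ℤ) :
    Matrix (Fin s) (AuxCol r s t) ℤ :=
  Matrix.of fun a c =>
    match c with
    | Sum.inl j => A2 a j
    | Sum.inr (Sum.inl _) => 0
    | Sum.inr (Sum.inr (Sum.inl j)) => if j = a then 1 else 0
    | Sum.inr (Sum.inr (Sum.inr j)) => if j = a then -1 else 0

/-- Feasibility in the auxiliary `n`-fold program: the auxiliary `n`-fold equations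
hold, the original coordinates obey the original bounds `l ≤ · ≤ u`, and every
auxiliary coordinate lies between `0` and `‖b‖_∞`. -/
def AuxFeasible {r s t n : ℕ} (A1 : Matrix (Fin r) (Fin t) ℤ)
    (A2 : Matrix (Fin s) (Fin t) ℤ) (l u : Fin n × Fin t → ℤ)
    (b : Fin r ⊕ Fin n × Fin s → ℤ) (z : Fin n × AuxCol r s t → ℤ) : Prop :=
  (nFold (auxA1 s A1) (auxA2 r A2) (Fin n)).mulVec z = b ∧
  (∀ i j, l (i, j) ≤ z (i, Sum.inl j) ∧ z (i, Sum.inl j) ≤ u (i, j)) ∧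
  (∀ i c, 0 ≤ z (i, Sum.inr c) ∧
    z (i, Sum.inr c) ≤ (Finset.univ.sup fun a => (b a).natAbs : ℕ))

/-- Global rows of the auxiliary `n`-fold product: the original row plus the difference of the
corresponding pair of auxiliary coordinates, summed over the bricks. -/
theorem nFold_aux_mulVec_inl {r s t n : ℕ} (A1 : Matrix (Fin r) (Fin t) ℤ)
    (A2 : Matrix (Fin s) (Fin t) ℤ) (z : Fin n × AuxCol r s t → ℤ) (a : Fin r) :
    (nFold (auxA1 s A1) (auxA2 r A2) (Fin n)).mulVec z (Sum.inl a) =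
      (nFold A1 A2 (Fin n)).mulVec (fun p => z (p.1, Sum.inl p.2)) (Sum.inl a) +
        ∑ i, (z (i, Sum.inr (Sum.inl (Sum.inl a))) - z (i, Sum.inr (Sum.inl (Sum.inr a)))) := by
  simp [nFold, auxA1, Matrix.mulVec, dotProduct, Fintype.sum_prod_type, Fintype.sum_sum_type,
    Finset.sum_add_distrib, sub_eq_add_neg]

/-- Local rows of the auxiliary `n`-fold product: the original row plus the difference of the
corresponding pair of auxiliary coordinates of that brick. -/
theorem nFold_aux_mulVec_inr {r s t n : ℕ} (A1 : Matrix (Fin r) (Fin t) ℤ)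
    (A2 : Matrix (Fin s) (Fin t) ℤ) (z : Fin n × AuxCol r s t → ℤ) (k : Fin n) (c : Fin s) :
    (nFold (auxA1 s A1) (auxA2 r A2) (Fin n)).mulVec z (Sum.inr (k, c)) =
      (nFold A1 A2 (Fin n)).mulVec (fun p => z (p.1, Sum.inl p.2)) (Sum.inr (k, c)) +
        (z (k, Sum.inr (Sum.inr (Sum.inl c))) - z (k, Sum.inr (Sum.inr (Sum.inr c)))) := by
  have brick_sum : ∀ {τ : Type} [Fintype τ] (v : Fin n → τ → ℤ) (w : τ → ℤ),
      ∑ i, ∑ j, (if i = k then w j else 0) * v i j = ∑ j, w j * v k j := by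
    intro τ _ v w
    rw [Finset.sum_eq_single k (fun i _ hi => by simp [hi]) (by simp)]
    simp
  simp only [nFold, Matrix.mulVec, dotProduct, Fintype.sum_prod_type, Matrix.of_apply]
  rw [brick_sum (fun i j => z (i, j)), brick_sum (fun i j => z (i, Sum.inl j))]
  simp [auxA2, Fintype.sum_sum_type, sub_eq_add_neg]

/-- When all auxiliary coordinates vanish, the auxiliary system is the original one. -/
theorem nFold_aux_mulVec_of_aux_eq_zero {r s t n : ℕ} (A1 : Matrix (Fin r) (Fin t) ℤ)
    (A2 : Matrix (Fin s) (Fin t) ℤ) (z : Fin n × AuxCol r s t → ℤ)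
    (hz : ∀ i c, z (i, Sum.inr c) = 0) :
    (nFold (auxA1 s A1) (auxA2 r A2) (Fin n)).mulVec z =
      (nFold A1 A2 (Fin n)).mulVec (fun p => z (p.1, Sum.inl p.2)) := by
  ext (a | ⟨k, c⟩)
  · simp [nFold_aux_mulVec_inl, hz]
  · simp [nFold_aux_mulVec_inr, hz]

/-- The point with zero original coordinates whose auxiliary coordinates are the positive and
negative parts of `b`, the global rows being served by the brick `i₀`. -/
def auxStart {r s n : ℕ} (t : ℕ) (b : Fin r ⊕ Fin n × Fin s → ℤ) (i₀ : Fin n) :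
    Fin n × AuxCol r s t → ℤ
  | (_, Sum.inl _) => 0
  | (i, Sum.inr (Sum.inl (Sum.inl a))) => if i = i₀ then (b (Sum.inl a))⁺ else 0
  | (i, Sum.inr (Sum.inl (Sum.inr a))) => if i = i₀ then (b (Sum.inl a))⁻ else 0
  | (i, Sum.inr (Sum.inr (Sum.inl c))) => (b (Sum.inr (i, c)))⁺
  | (i, Sum.inr (Sum.inr (Sum.inr c))) => (b (Sum.inr (i, c)))⁻

theorem auxFeasible_auxStart {r s t n : ℕ} (A1 : Matrix (Fin r) (Fin t) ℤ)
    (A2 : Matrix (Fin s) (Fin t) ℤ) (l u : Fin n × Fin t → ℤ)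
    (b : Fin r ⊕ Fin n × Fin s → ℤ) (i₀ : Fin n) (hlu : ∀ k, l k ≤ 0 ∧ 0 ≤ u k) :
    AuxFeasible A1 A2 l u b (auxStart t b i₀) := by
  have hb : ∀ a, |b a| ≤ ((Finset.univ.sup fun a => (b a).natAbs : ℕ) : ℤ) := fun a => by
    rw [Int.abs_eq_natAbs]
    exact_mod_cast Finset.le_sup (f := fun a => (b a).natAbs) (Finset.mem_univ a)
  have hpos : ∀ a, (b a)⁺ ≤ ((Finset.univ.sup fun a => (b a).natAbs : ℕ) : ℤ) := fun a =>
    (sup_le (le_abs_self _) (abs_nonneg _)).trans (hb a)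
  have hneg : ∀ a, (b a)⁻ ≤ ((Finset.univ.sup fun a => (b a).natAbs : ℕ) : ℤ) := fun a =>
    (sup_le (neg_le_abs _) (abs_nonneg _)).trans (hb a)
  refine ⟨?_, fun i j => hlu (i, j), ?_⟩
  · have h0 : (fun p : Fin n × Fin t => auxStart t b i₀ (p.1, Sum.inl p.2)) = 0 := rfl
    ext (a | ⟨k, c⟩)
    · rw [nFold_aux_mulVec_inl, h0]
      simp [auxStart, Finset.sum_sub_distrib]
    · rw [nFold_aux_mulVec_inr, h0]
      simp [auxStart]
  · rintro i ((a | a) | (c | c)) <;> simp only [auxStart]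
    · split_ifs
      · exact ⟨posPart_nonneg _, hpos _⟩
      · exact ⟨le_rfl, Int.natCast_nonneg _⟩
    · split_ifs
      · exact ⟨negPart_nonneg _, hneg _⟩
      · exact ⟨le_rfl, Int.natCast_nonneg _⟩
    · exact ⟨posPart_nonneg _, hpos _⟩
    · exact ⟨negPart_nonneg _, hneg _⟩

/-- (i) If `l ≤ 0 ≤ u` componentwise, the auxiliary `n`-fold program
has a feasible point. (ii) The original system `{x : A⁽ⁿ⁾x = b, l ≤ x ≤ u}` is
nonempty if and only if the auxiliary program has a feasible point whose objective
value (the sum of the auxiliary coordinates) is `0`. -/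
theorem auxiliary_program_feasibility {r s t n : ℕ} (hn : 0 < n)
    (A1 : Matrix (Fin r) (Fin t) ℤ) (A2 : Matrix (Fin s) (Fin t) ℤ)
    (l u : Fin n × Fin t → ℤ) (b : Fin r ⊕ Fin n × Fin s → ℤ) :
    ((∀ k, l k ≤ 0 ∧ 0 ≤ u k) → ∃ z, AuxFeasible A1 A2 l u b z) ∧
    ((∃ x : Fin n × Fin t → ℤ,
        (nFold A1 A2 (Fin n)).mulVec x = b ∧ l ≤ x ∧ x ≤ u) ↔
      ∃ z, AuxFeasible A1 A2 l u b z ∧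
        (∑ i : Fin n, ∑ c : (Fin r ⊕ Fin r) ⊕ (Fin s ⊕ Fin s), z (i, Sum.inr c))
          = 0) := by
  refine ⟨fun hlu => ⟨_, auxFeasible_auxStart A1 A2 l u b ⟨0, hn⟩ hlu⟩, ?_, ?_⟩
  · rintro ⟨x, hx, hl, hu⟩
    let z : Fin n × AuxCol r s t → ℤ := fun p => Sum.elim (fun j => x (p.1, j)) (fun _ => 0) p.2
    refine ⟨z, ⟨?_, fun i j => ⟨hl (i, j), hu (i, j)⟩,
      fun i c => ⟨le_rfl, Int.natCast_nonneg _⟩⟩, by simp [z]⟩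
    rw [nFold_aux_mulVec_of_aux_eq_zero A1 A2 z fun _ _ => rfl]
    exact hx
  · rintro ⟨z, ⟨hz, hbd, haux⟩, hobj⟩
    have hzero : ∀ i c, z (i, Sum.inr c) = 0 := fun i c => by
      have hi := (Finset.sum_eq_zero_iff_of_nonneg
        (fun i _ => Finset.sum_nonneg fun c _ => (haux i c).1)).1 hobj i (Finset.mem_univ i)
      exact (Finset.sum_eq_zero_iff_of_nonneg fun c _ => (haux i c).1).1 hi c (Finset.mem_univ c)
    refine ⟨fun p => z (p.1, Sum.inl p.2), ?_, fun p => (hbd p.1 p.2).1, fun p => (hbd p.1 p.2).2⟩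
    rw [← nFold_aux_mulVec_of_aux_eq_zero A1 A2 z hzero, hz]
end

section
/- Let A be an integer (r,s)×t bimatrix, let f : ℝ^{nt} → ℝ be separable convex with f(x) = Σᵢ fⁱ(xⁱ), each fⁱ : ℝᵗ → ℝ separable convex, let x be a feasible point of the n-fold system A⁽ⁿ⁾x = b, l ≤ x ≤ u with finite bounds, and let γ be a positive integer. Then there exists g = (g¹,…,gⁿ) ∈ ℤ^{nt} such that: every brick gⁱ lies in Z(A); every partial sum Σ_{j≤i} gʲ lies in Z(A); A₁·(Σ_{i=1}^n gⁱ) = 0; x + γg is feasible; f(x+γg) ≤ f(x); and f(x+γg) ≤ f(x+γḡ) for every ḡ ∈ 𝒢(A⁽ⁿ⁾) with l ≤ x + γḡ ≤ u. -/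
open Matrix

theorem ConformalLe.refl {ν : Type*} (x : ν → ℤ) : ConformalLe x x :=
  fun _ => ⟨mul_self_nonneg _, le_rfl⟩

theorem conformal_int_iff {a b : ℤ} :
    0 ≤ a * b ∧ |a| ≤ |b| ↔ a.toNat ≤ b.toNat ∧ (-a).toNat ≤ (-b).toNat := by
  rcases le_total 0 a with ha | ha <;> rcases le_total 0 b with hb | hb <;>
    simp only [abs_of_nonneg, abs_of_nonpos, ha, hb]
  · have := mul_nonneg ha hb
    omega
  · constructor
    · rintro ⟨h, h'⟩
      rcases ha.eq_or_lt with rfl | ha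
      · omega
      · rcases hb.eq_or_lt with rfl | hb
        · omega
        · nlinarith [mul_neg_of_pos_of_neg ha hb]
    · rintro ⟨h, h'⟩
      obtain rfl : a = 0 := by omega
      simp [hb]
  · constructor
    · rintro ⟨h, h'⟩
      rcases ha.eq_or_lt with rfl | ha
      · omega
      · rcases hb.eq_or_lt with rfl | hb
        · omega
        · nlinarith [mul_neg_of_neg_of_pos ha hb]
    · rintro ⟨h, h'⟩
      obtain rfl : a = 0 := by omega
      simp [hb]
  · have := mul_nonneg_of_nonpos_of_nonpos ha hb
    omega

theorem conformalLe_iff {ν : Type*} {x y : ν → ℤ} :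
    ConformalLe x y ↔ ∀ k, (x k).toNat ≤ (y k).toNat ∧ (-x k).toNat ≤ (-y k).toNat :=
  forall_congr' fun _ => conformal_int_iff

theorem ConformalLe.trans {ν : Type*} {x y z : ν → ℤ} (hxy : ConformalLe x y)
    (hyz : ConformalLe y z) : ConformalLe x z := by
  rw [conformalLe_iff] at *
  exact fun k => ⟨(hxy k).1.trans (hyz k).1, (hxy k).2.trans (hyz k).2⟩

instance {ν : Type*} : IsPreorder (ν → ℤ) ConformalLe where
  refl := ConformalLe.refl
  trans _ _ _ := ConformalLe.trans

/-- The Gordan–Dickson lemma for the conformal order. -/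
theorem wellQuasiOrdered_conformalLe (ν : Type*) [Finite ν] :
    WellQuasiOrdered (ConformalLe : (ν → ℤ) → (ν → ℤ) → Prop) := by
  intro f
  obtain ⟨m, n, hmn, h⟩ := wellQuasiOrdered_le (α := ν → ℕ × ℕ)
    fun i k => ((f i k).toNat, (-f i k).toNat)
  exact ⟨m, n, hmn, conformalLe_iff.2 fun k => h k⟩

theorem ConformalLe.sub {ν : Type*} {x y : ν → ℤ} (h : ConformalLe x y) :
    ConformalLe (y - x) y := by
  rw [conformalLe_iff] at *
  intro k
  have := h k
  simp only [Pi.sub_apply]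
  omega

theorem conformal_partial_sum {ι : Type*} [Fintype ι] {h : ι → ℤ} {z : ℤ} (hz : ∑ a, h a = z)
    (hc : ∀ a, 0 ≤ h a * z ∧ |h a| ≤ |z|) (S : Finset ι) :
    (0 ≤ (∑ a ∈ S, h a) * z ∧ |∑ a ∈ S, h a| ≤ |z|) ∧
      (∑ a ∈ S, h a = z → ∀ a ∉ S, h a = 0) := by
  classical
  wlog hz0 : 0 ≤ z generalizing h z
  · have := this (h := fun a => -h a) (z := -z) (by simp [hz]) (by simpa using hc) (by omega)
    simpa using this
  have hpos : ∀ a, 0 ≤ h a := fun a => by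
    have := conformal_int_iff.1 (hc a)
    omega
  have hsplit := Finset.sum_add_sum_compl S h
  have h1 : 0 ≤ ∑ a ∈ S, h a := Finset.sum_nonneg fun a _ => hpos a
  have h2 : 0 ≤ ∑ a ∈ Sᶜ, h a := Finset.sum_nonneg fun a _ => hpos a
  refine ⟨⟨mul_nonneg h1 hz0, ?_⟩, fun he a ha => ?_⟩
  · rw [abs_of_nonneg h1, abs_of_nonneg hz0]
    omega
  · have h3 : ∑ a ∈ Sᶜ, h a = 0 := by omega
    exact (Finset.sum_eq_zero_iff_of_nonneg fun a _ => hpos a).1 h3 a (by simpa using ha)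

theorem exists_graver_le {μ ν : Type*} [Fintype ν] (A : Matrix μ ν ℤ) {z : ν → ℤ}
    (hz : A.mulVec z = 0) (hz0 : z ≠ 0) : ∃ h ∈ GraverBasis A, ConformalLe h z := by
  have key : ∀ (m : ℕ) (z : ν → ℤ), ∑ k, (z k).natAbs = m → A.mulVec z = 0 → z ≠ 0 →
      ∃ h ∈ GraverBasis A, ConformalLe h z := by
    intro m
    induction m using Nat.strong_induction_on with
    | _ m ih =>
      intro z hm hz hz0
      by_cases hg : z ∈ GraverBasis A
      · exact ⟨z, hg, ConformalLe.refl z⟩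
      · simp only [GraverBasis, Set.mem_ofPred_eq, hz, true_and, not_and, not_forall] at hg
        obtain ⟨y, hy, hy0, hyz, hne⟩ := hg hz0
        have hyz' := conformalLe_iff.1 hyz
        obtain ⟨k, hk⟩ := Function.ne_iff.1 hne
        have hlt : ∑ k, (y k).natAbs < ∑ k, (z k).natAbs :=
          Finset.sum_lt_sum (fun k _ => by have := hyz' k; omega)
            ⟨k, Finset.mem_univ k, by have := hyz' k; omega⟩
        obtain ⟨h, hh, hhy⟩ := ih _ (hm ▸ hlt) y rfl hy hy0
        exact ⟨h, hh, hhy.trans hyz⟩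
  exact key _ z rfl hz hz0

/-- Every integer kernel vector is a conformal sum of Graver basis elements. -/
theorem exists_conformal_decomposition {μ ν : Type*} [Fintype ν] (A : Matrix μ ν ℤ) {z : ν → ℤ}
    (hz : A.mulVec z = 0) : ∃ (N : ℕ) (h : Fin N → ν → ℤ),
      (∀ a, h a ∈ GraverBasis A) ∧ (∀ a, ConformalLe (h a) z) ∧ ∑ a, h a = z := by
  have key : ∀ (m : ℕ) (z : ν → ℤ), ∑ k, (z k).natAbs = m → A.mulVec z = 0 →
      ∃ (N : ℕ) (h : Fin N → ν → ℤ),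
        (∀ a, h a ∈ GraverBasis A) ∧ (∀ a, ConformalLe (h a) z) ∧ ∑ a, h a = z := by
    intro m
    induction m using Nat.strong_induction_on with
    | _ m ih =>
      intro z hm hz
      by_cases hz0 : z = 0
      · exact ⟨0, Fin.elim0, fun a => a.elim0, fun a => a.elim0, by simp [hz0]⟩
      obtain ⟨y, hy, hyz⟩ := exists_graver_le A hz hz0
      have hyz' := conformalLe_iff.1 hyz
      obtain ⟨k, hk⟩ := Function.ne_iff.1 hy.2.1
      have hlt : ∑ k, ((z - y) k).natAbs < ∑ k, (z k).natAbs :=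
        Finset.sum_lt_sum (fun k _ => by have := hyz' k; simp only [Pi.sub_apply]; omega)
          ⟨k, Finset.mem_univ k, by
            have := hyz' k
            simp only [Pi.sub_apply, Pi.zero_apply] at *
            omega⟩
      obtain ⟨N, h, hh, hc, hs⟩ := ih _ (hm ▸ hlt) (z - y) rfl
        (by rw [Matrix.mulVec_sub, hz, hy.1, sub_zero])
      refine ⟨N + 1, Fin.cons y h, fun a => ?_, fun a => ?_, ?_⟩
      · refine Fin.cases hy hh a
      · refine Fin.cases hyz (fun a => (hc a).trans hyz.sub) a
      · simp [Fin.sum_univ_succ, hs]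
  exact key _ z rfl hz

theorem nFold_mulVec_eq_zero_iff {r s t n : ℕ} (A1 : Matrix (Fin r) (Fin t) ℤ)
    (A2 : Matrix (Fin s) (Fin t) ℤ) (x : Fin n × Fin t → ℤ) :
    (nFold A1 A2 (Fin n)).mulVec x = 0 ↔
      A1.mulVec (∑ i, brick x i) = 0 ∧ ∀ i, A2.mulVec (brick x i) = 0 := by
  have h1 : ∀ a, (nFold A1 A2 (Fin n)).mulVec x (Sum.inl a) =
      A1.mulVec (∑ i, brick x i) a := fun a => by
    simp only [Matrix.mulVec, dotProduct, nFold, Matrix.of_apply, Fintype.sum_prod_type,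
      Finset.sum_apply, brick, Finset.mul_sum]
    rw [Finset.sum_comm]
  have h2 : ∀ i c, (nFold A1 A2 (Fin n)).mulVec x (Sum.inr (i, c)) =
      A2.mulVec (brick x i) c := fun i c => by
    simp only [Matrix.mulVec, dotProduct, nFold, Matrix.of_apply, Fintype.sum_prod_type,
      brick, ite_mul, zero_mul]
    rw [Finset.sum_eq_single i] <;> simp +contextual
  constructor
  · intro h
    refine ⟨funext fun a => ?_, fun i => funext fun c => ?_⟩
    · rw [← h1, h]; rfl
    · rw [← h2, h]; rfl
  · rintro ⟨h, h'⟩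
    funext i
    rcases i with a | ⟨i, c⟩
    · rw [h1, h]; rfl
    · rw [h2, h']; rfl

/-- A finite family of Graver basis elements of `A2` whose sum is annihilated by `A1`, while no
sum over a nonempty proper subfamily is. -/
structure IsIndecomposable {r s t : ℕ} {ι : Type*} [Fintype ι] (A1 : Matrix (Fin r) (Fin t) ℤ)
    (A2 : Matrix (Fin s) (Fin t) ℤ) (h : ι → Fin t → ℤ) : Prop where
  mem_graver : ∀ a, h a ∈ GraverBasis A2
  mulVec_sum : A1.mulVec (∑ a, h a) = 0
  eq_univ : ∀ S : Finset ι, S.Nonempty → A1.mulVec (∑ a ∈ S, h a) = 0 → S = Finset.univ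

namespace IsIndecomposable

variable {r s t : ℕ} {A1 : Matrix (Fin r) (Fin t) ℤ} {A2 : Matrix (Fin s) (Fin t) ℤ}

theorem comp_equiv {ι κ : Type*} [Fintype ι] [Fintype κ] {h : ι → Fin t → ℤ}
    (hh : IsIndecomposable A1 A2 h) (e : κ ≃ ι) : IsIndecomposable A1 A2 (h ∘ e) where
  mem_graver a := hh.mem_graver _
  mulVec_sum := by
    simpa [Equiv.sum_comp e h] using hh.mulVec_sum
  eq_univ S hS h0 := by
    have := hh.eq_univ (S.map e.toEmbedding) (by simpa using hS) (by simpa using h0)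
    ext a
    have ha : e a ∈ S.map e.toEmbedding := this ▸ Finset.mem_univ _
    simpa using ha

theorem mem_graver_nFold {N : ℕ} {h : Fin N → Fin t → ℤ} (hh : IsIndecomposable A1 A2 h)
    (hN : 0 < N) : (fun k : Fin N × Fin t => h k.1 k.2) ∈
      GraverBasis (nFold A1 A2 (Fin N)) := by
  classical
  refine ⟨?_, ?_, fun y hy hy0 hyg => ?_⟩
  · rw [nFold_mulVec_eq_zero_iff]
    exact ⟨hh.mulVec_sum, fun i => (hh.mem_graver i).1⟩
  · intro h0
    exact (hh.mem_graver ⟨0, hN⟩).2.1 (funext fun j => congrFun h0 (⟨0, hN⟩, j))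
  · rw [nFold_mulVec_eq_zero_iff] at hy
    have hb : ∀ a, brick y a ≠ 0 → brick y a = h a := fun a ha =>
      (hh.mem_graver a).2.2 _ (hy.2 a) ha fun j => hyg (a, j)
    have hS := hh.eq_univ {a | brick y a ≠ 0} ?_ ?_
    · funext ⟨a, j⟩
      have ha := Finset.mem_univ a
      rw [← hS] at ha
      exact congrFun (hb a (by simpa using ha)) j
    · by_contra hne
      apply hy0
      funext ⟨a, j⟩
      rw [Finset.not_nonempty_iff_eq_empty, Finset.filter_eq_empty_iff] at hne
      exact congrFun (not_not.1 (hne (Finset.mem_univ a))) j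
    · rw [← hy.1]
      congr 1
      rw [Finset.sum_filter]
      refine Finset.sum_congr rfl fun a _ => ?_
      split_ifs with ha
      · exact (hb a ha).symm
      · exact (not_not.1 ha).symm

theorem ofFn_eq {N M : ℕ} {h : Fin N → Fin t → ℤ} {k : Fin M → Fin t → ℤ}
    (hh : IsIndecomposable A1 A2 h) (hk : IsIndecomposable A1 A2 k) (hN : 0 < N)
    (hle : List.SublistForall₂ ConformalLe (List.ofFn h) (List.ofFn k)) : N = M := by
  obtain ⟨l, hl, hsub⟩ := List.sublistForall₂_iff.1 hle
  have hmem : ∀ x ∈ List.ofFn h, x ∈ GraverBasis A2 := by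
    simpa [List.mem_ofFn] using hh.mem_graver
  have hmem' : ∀ x ∈ l, x ∈ GraverBasis A2 := fun x hx => by
    obtain ⟨a, rfl⟩ := List.mem_ofFn.1 (hsub.subset hx)
    exact hk.mem_graver a
  have heq : List.ofFn h = l := by
    rw [← List.forall₂_eq_eq_eq]
    rw [List.forall₂_iff_get] at hl ⊢
    refine ⟨hl.1, fun i h₁ h₂ => ?_⟩
    have hx := hmem _ (List.get_mem _ ⟨i, h₁⟩)
    have hy := hmem' _ (List.get_mem _ ⟨i, h₂⟩)
    exact hy.2.2 _ hx.1 hx.2.1 (hl.2 i h₁ h₂)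
  subst heq
  obtain ⟨f, hf⟩ := List.sublist_iff_exists_fin_orderEmbedding_get_eq.1 hsub
  let e : Fin N ↪ Fin M :=
    (finCongr (List.length_ofFn (f := h))).symm.toEmbedding.trans
      (f.toEmbedding.trans (finCongr (List.length_ofFn (f := k))).toEmbedding)
  have he : ∀ a, h a = k (e a) := fun a => by
    have := hf ((finCongr (List.length_ofFn (f := h))).symm a)
    simp only [List.get_ofFn] at this
    exact this
  have hS := hk.eq_univ (Finset.univ.map e) ⟨e ⟨0, hN⟩, by simp⟩ (by
    simpa [← he] using hh.mulVec_sum)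
  simpa using congrArg Finset.card hS

theorem exists_bound (A1 : Matrix (Fin r) (Fin t) ℤ) (A2 : Matrix (Fin s) (Fin t) ℤ) :
    ∃ B : ℕ, ∀ (N : ℕ) (h : Fin N → Fin t → ℤ), IsIndecomposable A1 A2 h → N ≤ B := by
  by_contra! hcon
  choose N h hh hN using hcon
  let φ : ℕ → ℕ := fun m => Nat.rec 0 (fun _ b => N b) m
  have hφ : StrictMono fun m => N (φ m) := strictMono_nat_of_lt_succ fun m => hN (N (φ m))
  have hpwo := Set.PartiallyWellOrderedOn.partiallyWellOrderedOn_sublistForall₂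
    (ConformalLe : (Fin t → ℤ) → (Fin t → ℤ) → Prop) (s := Set.univ)
    (Set.partiallyWellOrderedOn_of_wellQuasiOrdered (wellQuasiOrdered_conformalLe _) _)
  obtain ⟨m, n, hmn, hle⟩ := hpwo.exists_lt (f := fun m => List.ofFn (h (φ m))) (by simp)
  exact (hφ hmn).ne ((hh (φ m)).ofFn_eq (hh (φ n)) (Nat.zero_lt_of_lt (hN _)) hle)

end IsIndecomposable

section Decomposition

variable {r s t n : ℕ} {A1 : Matrix (Fin r) (Fin t) ℤ} {A2 : Matrix (Fin s) (Fin t) ℤ}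

/-- A Graver basis element of an `n`-fold product splits brickwise into an indecomposable
family. -/
theorem exists_indecomposable {g : Fin n × Fin t → ℤ}
    (hg : g ∈ GraverBasis (nFold A1 A2 (Fin n))) :
    ∃ (N : Fin n → ℕ) (h : (Σ i, Fin (N i)) → Fin t → ℤ),
      IsIndecomposable A1 A2 h ∧ ∀ i, ∑ a, h ⟨i, a⟩ = brick g i := by
  classical
  have hg0 := (nFold_mulVec_eq_zero_iff A1 A2 g).1 hg.1
  choose N h hmem hc hsum using fun i => exists_conformal_decomposition A2 (hg0.2 i)
  refine ⟨N, fun a => h a.1 a.2, ⟨fun a => hmem _ _, ?_, fun S hS h0 => ?_⟩, hsum⟩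
  · rw [Fintype.sum_sigma]
    simpa [hsum] using hg0.1
  let T : ∀ i, Finset (Fin (N i)) := fun i => {a | (⟨i, a⟩ : Σ i, Fin (N i)) ∈ S}
  have hST : S = Finset.univ.sigma T := by
    ext ⟨i, a⟩
    simp [T]
  have hcoord : ∀ i j, ∑ a, h i a j = g (i, j) := fun i j => by
    rw [← Finset.sum_apply, hsum]
    rfl
  have hps := fun i j => conformal_partial_sum (hcoord i j) (fun a => hc i a j)
  let y : Fin n × Fin t → ℤ := fun k => ∑ a ∈ T k.1, h k.1 a k.2
  have hyb : ∀ i, brick y i = ∑ a ∈ T i, h i a := fun i => by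
    funext j
    simp [brick, y]
  have hy : (nFold A1 A2 (Fin n)).mulVec y = 0 := by
    rw [nFold_mulVec_eq_zero_iff]
    refine ⟨?_, fun i => ?_⟩
    · rw [← h0, hST, Finset.sum_sigma]
      simp only [hyb]
    · rw [hyb, Matrix.mulVec_sum]
      exact Finset.sum_eq_zero fun a _ => (hmem i a).1
  have hy0 : y ≠ 0 := by
    intro hy0
    obtain ⟨⟨i, a⟩, ha⟩ := hS
    refine (hmem i a).2.1 (funext fun j => ?_)
    refine (hps i j (T i)ᶜ).2 ?_ a (by simpa [T] using ha)
    have h1 := Finset.sum_add_sum_compl (T i) fun a => h i a j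
    have h2 : ∑ a ∈ T i, h i a j = 0 := congrFun hy0 (i, j)
    rw [← hcoord, ← h1, h2, zero_add]
  have hyg : y = g := hg.2.2 y hy hy0 fun k => (hps k.1 k.2 (T k.1)).1
  ext ⟨i, a⟩
  simp only [Finset.mem_univ, iff_true]
  by_contra ha
  exact (hmem i a).2.1 (funext fun j =>
    (hps i j (T i)).2 (congrFun hyg (i, j)) a (by simpa [T] using ha))

variable (A1 A2) in
theorem bddAbove_graverComplexity :
    BddAbove {k : ℕ | ∃ (n : ℕ) (g : Fin n × Fin t → ℤ),
      g ∈ GraverBasis (nFold A1 A2 (Fin n)) ∧ k = {i : Fin n | brick g i ≠ 0}.ncard} := by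
  obtain ⟨B, hB⟩ := IsIndecomposable.exists_bound A1 A2
  refine ⟨B, ?_⟩
  rintro k ⟨n, g, hg, rfl⟩
  obtain ⟨N, h, hh, hsum⟩ := exists_indecomposable hg
  refine le_trans ?_ (hB _ _ (hh.comp_equiv (Fintype.equivFin _).symm))
  rw [Fintype.card_sigma, Set.ncard_eq_toFinset_card', Finset.card_eq_sum_ones]
  refine (Finset.sum_le_sum fun i hi => ?_).trans
    (Finset.sum_le_sum_of_subset (Finset.subset_univ _))
  rw [Fintype.card_fin, Nat.one_le_iff_ne_zero]
  intro h0
  have : IsEmpty (Fin (N i)) := by rw [h0]; infer_instance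
  exact (Set.mem_toFinset.1 hi) (by rw [← hsum i]; simp)

theorem IsIndecomposable.card_le {ι : Type*} [Fintype ι] {h : ι → Fin t → ℤ}
    (hh : IsIndecomposable A1 A2 h) : Fintype.card ι ≤ graverComplexity A1 A2 := by
  rcases Nat.eq_zero_or_pos (Fintype.card ι) with h0 | hpos
  · omega
  have hk := hh.comp_equiv (Fintype.equivFin ι).symm
  refine le_csSup (bddAbove_graverComplexity A1 A2) ⟨_, _, hk.mem_graver_nFold hpos, ?_⟩
  have huniv : {i | brick (fun k : Fin (Fintype.card ι) × Fin t =>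
      (h ∘ (Fintype.equivFin ι).symm) k.1 k.2) i ≠ 0} = Set.univ :=
    Set.eq_univ_of_forall fun i => (hk.mem_graver i).2.1
  rw [huniv, Set.ncard_univ, Nat.card_fin]

theorem IsIndecomposable.sum_mem_ZSet {ι : Type*} [Fintype ι] {h : ι → Fin t → ℤ}
    (hh : IsIndecomposable A1 A2 h) (S : Finset ι) : ∑ a ∈ S, h a ∈ ZSet A1 A2 := by
  refine ⟨S.toList.map h, ?_, ?_, ?_⟩
  · rw [List.length_map, Finset.length_toList]
    exact (Finset.card_le_univ S).trans hh.card_le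
  · intro x hx
    obtain ⟨a, -, rfl⟩ := List.mem_map.1 hx
    exact hh.mem_graver a
  · rw [Finset.sum_map_toList]

theorem sum_brick_mem_ZSet {g : Fin n × Fin t → ℤ}
    (hg : g ∈ GraverBasis (nFold A1 A2 (Fin n))) (T : Finset (Fin n)) :
    ∑ i ∈ T, brick g i ∈ ZSet A1 A2 := by
  obtain ⟨N, h, hh, hsum⟩ := exists_indecomposable hg
  have := hh.sum_mem_ZSet (T.sigma fun _ => Finset.univ)
  simpa [Finset.sum_sigma, hsum] using this

variable (A1 A2) in
theorem zero_mem_ZSet : (0 : Fin t → ℤ) ∈ ZSet A1 A2 :=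
  ⟨[], by simp⟩

end Decomposition

theorem finite_setOf_step_mem_Icc {ν : Type*} [Finite ν] (l u x : ν → ℤ) {γ : ℕ} (hγ : 0 < γ) :
    {g : ν → ℤ | l ≤ x + (γ : ℤ) • g ∧ x + (γ : ℤ) • g ≤ u}.Finite := by
  classical
  have := Fintype.ofFinite ν
  refine Set.Finite.of_finite_image ((Set.finite_Icc l u).subset ?_)
    (f := fun g => x + (γ : ℤ) • g) fun a _ b _ hab => ?_
  · rintro _ ⟨g, hg, rfl⟩
    exact hg
  · have hγ' : (γ : ℤ) ≠ 0 := by omega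
    exact smul_right_injective _ hγ' (add_left_cancel hab)

/-- Given a separable convex `f(x) = ∑ₖ fₖ(xₖ)`, a feasible point `x`
of the `n`-fold system, and a positive integer `γ`, there is a vector `g` all of whose
bricks and partial brick sums lie in `Z(A)`, with `A₁ (∑ᵢ gⁱ) = 0`, such that `x + γ g`
is feasible, `f(x+γg) ≤ f(x)`, and `f(x+γg) ≤ f(x+γḡ)` for every `ḡ ∈ 𝒢(A⁽ⁿ⁾)` with
`x + γ ḡ` within the bounds. -/
theorem exists_good_step_separable_convex {r s t n : ℕ}
    (A1 : Matrix (Fin r) (Fin t) ℤ) (A2 : Matrix (Fin s) (Fin t) ℤ)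
    (l u : Fin n × Fin t → ℤ) (b : Fin r ⊕ Fin n × Fin s → ℤ)
    (f : (Fin n × Fin t → ℝ) → ℝ) (fk : Fin n × Fin t → ℝ → ℝ)
    (hconv : ∀ k, ConvexOn ℝ Set.univ (fk k))
    (hf : ∀ y, f y = ∑ k, fk k (y k))
    (x : Fin n × Fin t → ℤ)
    (hxb : (nFold A1 A2 (Fin n)).mulVec x = b) (hxl : l ≤ x) (hxu : x ≤ u)
    (γ : ℕ) (hγ : 0 < γ) :
    ∃ g : Fin n × Fin t → ℤ,
      (∀ i, brick g i ∈ ZSet A1 A2) ∧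
      (∀ i : Fin n, (fun j => ∑ i' ∈ Finset.univ.filter (· ≤ i), g (i', j))
          ∈ ZSet A1 A2) ∧
      A1.mulVec (fun j => ∑ i, brick g i j) = 0 ∧
      (nFold A1 A2 (Fin n)).mulVec (x + (γ : ℤ) • g) = b ∧
      l ≤ x + (γ : ℤ) • g ∧ x + (γ : ℤ) • g ≤ u ∧
      f (fun k => ((x + (γ : ℤ) • g) k : ℝ)) ≤ f (fun k => (x k : ℝ)) ∧
      ∀ gbar ∈ GraverBasis (nFold A1 A2 (Fin n)),
        l ≤ x + (γ : ℤ) • gbar → x + (γ : ℤ) • gbar ≤ u →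
        f (fun k => ((x + (γ : ℤ) • g) k : ℝ)) ≤
          f (fun k => ((x + (γ : ℤ) • gbar) k : ℝ)) := by
  classical
  have hfin : ({g : Fin n × Fin t → ℤ | (g = 0 ∨ g ∈ GraverBasis (nFold A1 A2 (Fin n))) ∧
      l ≤ x + (γ : ℤ) • g ∧ x + (γ : ℤ) • g ≤ u}).Finite :=
    (finite_setOf_step_mem_Icc l u x hγ).subset fun g hg => hg.2
  obtain ⟨g, ⟨hg, hgl, hgu⟩, hmin⟩ := Set.exists_min_image _
    (fun g : Fin n × Fin t → ℤ => f fun k => ((x + (γ : ℤ) • g) k : ℝ)) hfin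
    ⟨0, Or.inl rfl, by simpa using hxl, by simpa using hxu⟩
  have hker : (nFold A1 A2 (Fin n)).mulVec g = 0 := by
    rcases hg with rfl | hg
    · exact Matrix.mulVec_zero _
    · exact hg.1
  have hZ : ∀ T : Finset (Fin n), ∑ i ∈ T, brick g i ∈ ZSet A1 A2 := fun T => by
    rcases hg with rfl | hg
    · convert zero_mem_ZSet A1 A2
      exact Finset.sum_eq_zero fun i _ => rfl
    · exact sum_brick_mem_ZSet hg T
  refine ⟨g, fun i => by simpa using hZ {i}, fun i => ?_, ?_, ?_, hgl, hgu, ?_, ?_⟩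
  · convert hZ (Finset.univ.filter (· ≤ i)) using 1
    funext j
    simp [brick]
  · convert ((nFold_mulVec_eq_zero_iff A1 A2 g).1 hker).1 using 2
    funext j
    simp
  · rw [Matrix.mulVec_add, Matrix.mulVec_smul, hker, smul_zero, add_zero, hxb]
  · simpa using hmin 0 ⟨Or.inl rfl, by simpa using hxl, by simpa using hxu⟩
  · exact fun gbar hgbar hl hu => hmin gbar ⟨Or.inr hgbar, hl, hu⟩
end
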